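/- First-moment cancellation for 𝔞 ≥ 1: Let 𝔞 ≥ 1, let X and Y be independent Gamma(𝔞,𝔟)-distributed random variables, and let 𝑓 > 0, τ ∈ (0,∞]. Then there is a constant C (independent of 𝑓 and τ) such that | (𝔞−1) 𝑓 E[ (Y/X) 1{X > 𝑓Y} 1{Y ≤ τ} ] − 𝔟 𝑓 E[ Y 1{Y ≤ τ} ] | ≤ C 𝑓^𝔞. -/

import Mathlib

open MeasureTheory ProbabilityTheory Filter Finset
open scoped ENNReal

noncomputable section

/-- Integrability against the gamma weight over a half-line bounded away from `0`. -/
theorem integrableOn_Ioi_rpow_sub_one_mul_exp {s b t : ℝ} (hs : 0 ≤ s) (hb : 0 < b) (ht : 0 < t) :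
    IntegrableOn (fun x : ℝ => x ^ (s - 1) * Real.exp (-b * x)) (Set.Ioi t) := by
  have h : IntegrableOn (fun x : ℝ => x ^ s * Real.exp (-b * x)) (Set.Ioi t) := by
    have h0 := integrableOn_rpow_mul_exp_neg_mul_rpow (p := 1) (s := s) (by linarith) one_pos hb
    simp only [Real.rpow_one] at h0
    exact h0.mono_set (Set.Ioi_subset_Ioi ht.le)
  refine (h.const_mul t⁻¹).mono' (by fun_prop) ?_
  filter_upwards [ae_restrict_mem measurableSet_Ioi] with x hx
  have hx' : t < x := hx
  have hx0 : 0 < x := ht.trans hx'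
  rw [Real.norm_of_nonneg (by positivity), Real.rpow_sub_one hx0.ne', div_eq_inv_mul, mul_assoc]
  gcongr

/-- Integration by parts for the incomplete gamma integral. -/
theorem mul_integral_Ioi_rpow_sub_one_mul_exp {s b t : ℝ} (hs : 0 ≤ s) (hb : 0 < b) (ht : 0 < t) :
    s * ∫ x in Set.Ioi t, x ^ (s - 1) * Real.exp (-b * x) =
      b * (∫ x in Set.Ioi t, x ^ s * Real.exp (-b * x)) - t ^ s * Real.exp (-b * t) := by
  have h1 := integrableOn_Ioi_rpow_sub_one_mul_exp hs hb ht
  have h2 := integrableOn_Ioi_rpow_sub_one_mul_exp (s := s + 1) (by linarith) hb ht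
  rw [add_sub_cancel_right] at h2
  have key := integral_Ioi_of_hasDerivAt_of_tendsto'
    (f := fun x : ℝ => x ^ s * Real.exp (-b * x))
    (f' := fun x => s * (x ^ (s - 1) * Real.exp (-b * x)) - b * (x ^ s * Real.exp (-b * x)))
    (a := t) (fun x hx => ?_) ((h1.const_mul s).sub (h2.const_mul b))
    (tendsto_rpow_mul_exp_neg_mul_atTop_nhds_zero s b hb)
  · rw [integral_sub (h1.const_mul s) (h2.const_mul b), integral_const_mul,
      integral_const_mul] at key
    linarith
  · have hx0 : 0 < x := ht.trans_le hx
    have d1 := Real.hasDerivAt_rpow_const (p := s) (Or.inl hx0.ne')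
    have d2 := ((hasDerivAt_id x).const_mul (-b)).exp
    refine (d1.mul d2).congr_deriv ?_
    simp only [id]
    ring

/-- An upper bound for the lower incomplete gamma integral. -/
theorem mul_setIntegral_Ioc_rpow_mul_exp_le {s b t : ℝ} (hs : 0 ≤ s) (hb : 0 < b) (ht : 0 < t) :
    b * ∫ x in Set.Ioc 0 t, x ^ s * Real.exp (-b * x) ≤ t ^ s := by
  have he : IntegrableOn (fun x : ℝ => Real.exp (-b * x)) (Set.Ioi 0) :=
    integrableOn_exp_mul_Ioi (by linarith) 0
  have h1 : ∫ x in Set.Ioc 0 t, x ^ s * Real.exp (-b * x) ≤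
      ∫ x in Set.Ioc 0 t, t ^ s * Real.exp (-b * x) := by
    refine integral_mono_of_nonneg ?_ ((he.mono_set Set.Ioc_subset_Ioi_self).const_mul _) ?_
    · filter_upwards [ae_restrict_mem measurableSet_Ioc] with x hx
      have := hx.1
      simp only [Pi.zero_apply]
      positivity
    · filter_upwards [ae_restrict_mem measurableSet_Ioc] with x hx
      have h0 := hx.1
      have h3 := hx.2
      gcongr
  have h2 : ∫ x in Set.Ioc 0 t, Real.exp (-b * x) ≤ 1 / b := by
    have h3 : ∫ x in Set.Ioi (0 : ℝ), Real.exp (-b * x) = 1 / b := by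
      rw [integral_exp_mul_Ioi (by linarith)]
      simp
    rw [← h3]
    exact setIntegral_mono_set he (ae_of_all _ fun x => (Real.exp_pos _).le)
      Set.Ioc_subset_Ioi_self.eventuallyLE
  rw [integral_const_mul] at h1
  calc _ ≤ b * (t ^ s * (1 / b)) := by gcongr; exact h1.trans (by gcongr)
    _ = t ^ s := by field_simp

theorem measurable_gammaPDF (a b : ℝ) : Measurable (gammaPDF a b) :=
  (measurable_gammaPDFReal a b).ennreal_ofReal

theorem integral_gammaMeasure {a b : ℝ} (ha : 0 < a) (hb : 0 < b) (g : ℝ → ℝ) :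
    ∫ x, g x ∂gammaMeasure a b =
      b ^ a / Real.Gamma a * ∫ x in Set.Ioi 0, x ^ (a - 1) * Real.exp (-b * x) * g x := by
  rw [gammaMeasure, integral_withDensity_eq_integral_toReal_smul
    (measurable_gammaPDF a b) (ae_of_all _ fun _ => ENNReal.ofReal_lt_top),
    ← integral_const_mul, ← integral_Ici_eq_integral_Ioi, ← integral_indicator measurableSet_Ici]
  congr 1 with x
  rw [gammaPDF, ENNReal.toReal_ofReal (gammaPDFReal_nonneg ha hb x), gammaPDFReal]
  by_cases hx : 0 ≤ x
  · simp only [hx, if_true, Set.mem_Ici, Set.indicator_of_mem, smul_eq_mul, neg_mul]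
    ring
  · simp [hx]

theorem ae_pos_gammaMeasure (a b : ℝ) : ∀ᵐ x ∂gammaMeasure a b, 0 < x := by
  have h0 : ∀ᵐ x ∂(volume : Measure ℝ), x ≠ 0 := by simp [ae_iff]
  rw [gammaMeasure, ae_withDensity_iff (measurable_gammaPDF a b)]
  filter_upwards [h0] with x hx h
  by_contra hn
  exact h (gammaPDF_of_neg (lt_of_le_of_ne (not_lt.mp hn) hx))

theorem integrable_rpow_gammaMeasure {a b p : ℝ} (ha : 0 < a) (hb : 0 < b) (hp : 0 < p) :
    Integrable (fun x : ℝ => x ^ p) (gammaMeasure a b) := by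
  rw [gammaMeasure, integrable_withDensity_iff_integrable_smul'
    (measurable_gammaPDF a b) (ae_of_all _ fun _ => ENNReal.ofReal_lt_top)]
  have h0 := integrableOn_rpow_mul_exp_neg_mul_rpow (p := 1) (s := a - 1 + p) (by linarith)
    one_pos hb
  simp only [Real.rpow_one] at h0
  refine (IntegrableOn.integrable_indicator (h0.const_mul (b ^ a / Real.Gamma a))
    measurableSet_Ioi).congr ?_
  refine ae_of_all _ fun x => ?_
  dsimp only
  rw [gammaPDF, ENNReal.toReal_ofReal (gammaPDFReal_nonneg ha hb x), gammaPDFReal]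
  rcases lt_trichotomy x 0 with hx | rfl | hx
  · simp [hx.not_gt, hx.not_ge]
  · simp [Real.zero_rpow hp.ne']
  · simp only [hx, hx.le, if_true, Set.mem_Ioi, Set.indicator_of_mem, smul_eq_mul, neg_mul,
      Real.rpow_add hx]
    ring

/-- The truncated inverse moment of the gamma distribution differs from its rate by
`O(t ^ (a - 1))`. -/
theorem abs_truncated_inverse_moment_sub_le {a b t : ℝ} (ha : 1 ≤ a) (hb : 0 < b) (ht : 0 < t) :
    |(a - 1) * (∫ x, (if t < x then x⁻¹ else 0) ∂gammaMeasure a b) - b| ≤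
      2 * (b ^ a / Real.Gamma a) * t ^ (a - 1) := by
  have ha0 : 0 < a := by linarith
  have hs : 0 ≤ a - 1 := by linarith
  have hG := Real.Gamma_pos_of_pos ha0
  set K := b ^ a / Real.Gamma a with hK
  have hK0 : 0 < K := by positivity
  have h1 : ∫ x, (if t < x then x⁻¹ else 0) ∂gammaMeasure a b =
      K * ∫ x in Set.Ioi t, x ^ (a - 1 - 1) * Real.exp (-b * x) := by
    rw [integral_gammaMeasure ha0 hb, ← integral_indicator measurableSet_Ioi,
      ← integral_indicator measurableSet_Ioi]
    congr 2 with x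
    by_cases hx : t < x
    · have hx0 : 0 < x := ht.trans hx
      simp only [Set.mem_Ioi, hx, hx0, Set.indicator_of_mem, if_true,
        Real.rpow_sub_one hx0.ne' (a - 1)]
      ring
    · simp [hx]
  have hint : IntegrableOn (fun x : ℝ => x ^ (a - 1) * Real.exp (-b * x)) (Set.Ioi 0) := by
    have h0 := integrableOn_rpow_mul_exp_neg_mul_rpow (p := 1) (s := a - 1) (by linarith)
      one_pos hb
    simpa only [Real.rpow_one] using h0
  have h2 : K * ∫ x in Set.Ioi 0, x ^ (a - 1) * Real.exp (-b * x) = 1 := by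
    have := isProbabilityMeasure_gammaMeasure ha0 hb
    have h := integral_gammaMeasure ha0 hb (fun _ => 1)
    simp only [mul_one, integral_const, probReal_univ, smul_eq_mul] at h
    exact h.symm
  have h3 : ∫ x in Set.Ioi 0, x ^ (a - 1) * Real.exp (-b * x) =
      (∫ x in Set.Ioc 0 t, x ^ (a - 1) * Real.exp (-b * x)) +
        ∫ x in Set.Ioi t, x ^ (a - 1) * Real.exp (-b * x) := by
    rw [← Set.Ioc_union_Ioi_eq_Ioi ht.le]
    exact setIntegral_union (Set.Ioc_disjoint_Ioi le_rfl) measurableSet_Ioi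
      (hint.mono_set Set.Ioc_subset_Ioi_self) (hint.mono_set (Set.Ioi_subset_Ioi ht.le))
  have h4 := mul_integral_Ioi_rpow_sub_one_mul_exp hs hb ht
  have h5 := mul_setIntegral_Ioc_rpow_mul_exp_le hs hb ht
  have h6 : 0 ≤ ∫ x in Set.Ioc 0 t, x ^ (a - 1) * Real.exp (-b * x) :=
    setIntegral_nonneg measurableSet_Ioc fun x hx => by
      have := hx.1
      positivity
  have h7 : t ^ (a - 1) * Real.exp (-b * t) ≤ t ^ (a - 1) :=
    mul_le_of_le_one_right (by positivity) (Real.exp_le_one_iff.mpr (by nlinarith))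
  have h8 : 0 ≤ t ^ (a - 1) * Real.exp (-b * t) := by positivity
  have h9 : (a - 1) * (∫ x, (if t < x then x⁻¹ else 0) ∂gammaMeasure a b) - b =
      -(K * (b * (∫ x in Set.Ioc 0 t, x ^ (a - 1) * Real.exp (-b * x)) +
        t ^ (a - 1) * Real.exp (-b * t))) := by
    rw [h1]
    rw [h3] at h2
    linear_combination K * h4 + b * h2
  rw [h9, abs_neg, abs_of_nonneg (by positivity)]
  nlinarith

/-- Lemma: first-moment cancellation for `𝔞 ≥ 1`.
For independent `Gamma(𝔞,𝔟)` variables `X, Y`, `𝑓 > 0` and `τ ∈ (0,∞]`: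
`|(𝔞-1) 𝑓 E[(Y/X) 1{X > 𝑓Y} 1{Y ≤ τ}] - 𝔟 𝑓 E[Y 1{Y ≤ τ}]| ≤ C 𝑓^𝔞`,
with `C` independent of `𝑓` and `τ`. -/
theorem first_moment_cancellation
    {Ω : Type} [MeasurableSpace Ω] (P : Measure Ω) [IsProbabilityMeasure P]
    (X Y : Ω → ℝ) (hX : Measurable X) (hY : Measurable Y)
    (hindep : IndepFun X Y P)
    (𝔞 𝔟 : ℝ) (h𝔞 : 1 ≤ 𝔞) (h𝔟 : 0 < 𝔟)
    (hXg : Measure.map X P = gammaMeasure 𝔞 𝔟)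
    (hYg : Measure.map Y P = gammaMeasure 𝔞 𝔟) :
    ∃ C : ℝ, 0 < C ∧
      ∀ (c : ℝ) (τ : ℝ≥0∞), 0 < c → 0 < τ →
        |(𝔞 - 1) * c * (∫ ω, (Y ω / X ω) *
              (if c * Y ω < X ω ∧ ENNReal.ofReal (Y ω) ≤ τ then (1 : ℝ) else 0) ∂P)
          - 𝔟 * c * (∫ ω, Y ω * (if ENNReal.ofReal (Y ω) ≤ τ then (1 : ℝ) else 0) ∂P)|
          ≤ C * c ^ 𝔞 := by
  have ha0 : 0 < 𝔞 := by linarith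
  have hγ := isProbabilityMeasure_gammaMeasure ha0 h𝔟
  set γ := gammaMeasure 𝔞 𝔟 with hγdef
  have hK0 : 0 < 𝔟 ^ 𝔞 / Real.Gamma 𝔞 := by
    have := Real.Gamma_pos_of_pos ha0
    positivity
  set K := 𝔟 ^ 𝔞 / Real.Gamma 𝔞 with hK
  have hpos : ∀ᵐ y ∂γ, 0 < y := ae_pos_gammaMeasure 𝔞 𝔟
  have hM : 0 ≤ ∫ y, y ^ 𝔞 ∂γ := integral_nonneg_of_ae <| by
    filter_upwards [hpos] with y hy
    exact (Real.rpow_pos_of_pos hy _).le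
  refine ⟨2 * K * (∫ y, y ^ 𝔞 ∂γ) + 1, by positivity, fun c τ hc _ => ?_⟩
  have hmap : Measure.map (fun ω => (X ω, Y ω)) P = γ.prod γ := by
    rw [hindep.map_prod_eq_prod_map_map hX.aemeasurable hY.aemeasurable, hXg, hYg]
  set F : ℝ × ℝ → ℝ := fun z => (z.2 / z.1) *
    (if c * z.2 < z.1 ∧ ENNReal.ofReal z.2 ≤ τ then (1 : ℝ) else 0) with hF
  set I : ℝ → ℝ := fun y => if ENNReal.ofReal y ≤ τ then (1 : ℝ) else 0 with hI
  set J : ℝ → ℝ := fun t => ∫ x, (if t < x then x⁻¹ else 0) ∂γ with hJ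
  have hIm : Measurable I := Measurable.ite
    (measurableSet_le ENNReal.measurable_ofReal measurable_const) measurable_const measurable_const
  have hI01 : ∀ y, 0 ≤ I y ∧ I y ≤ 1 := fun y => by
    simp only [hI]
    split_ifs <;> norm_num
  have hFm : Measurable F := (measurable_snd.div measurable_fst).mul <| Measurable.ite
    ((measurableSet_lt (measurable_snd.const_mul c) measurable_fst).inter
      (measurableSet_le (ENNReal.measurable_ofReal.comp measurable_snd) measurable_const))
    measurable_const measurable_const
  have hFint : Integrable F (γ.prod γ) := by
    have h2 : ∀ᵐ z ∂γ.prod γ, 0 < z.2 := Measure.quasiMeasurePreserving_snd.ae hpos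
    refine (integrable_const c⁻¹).mono' hFm.aestronglyMeasurable ?_
    filter_upwards [h2] with z hz
    simp only [hF]
    split_ifs with h
    · have hcz : 0 < c * z.2 := by positivity
      have hz1 : 0 < z.1 := hcz.trans h.1
      rw [mul_one, Real.norm_of_nonneg (by positivity), div_le_iff₀ hz1, ← div_eq_inv_mul,
        le_div_iff₀ hc]
      linarith [h.1]
    · simp [hc.le]
  have hE2 : ∫ ω, Y ω * (if ENNReal.ofReal (Y ω) ≤ τ then (1 : ℝ) else 0) ∂P =
      ∫ y, y * I y ∂γ := by
    rw [← hYg]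
    exact (integral_map hY.aemeasurable (measurable_id.mul hIm).aestronglyMeasurable).symm
  have hinner : ∀ y, ∫ x, F (x, y) ∂γ = y * I y * J (c * y) := fun y => by
    rw [hJ, ← integral_const_mul]
    congr 1 with x
    simp only [hF, hI]
    by_cases h1 : c * y < x <;> by_cases h2 : ENNReal.ofReal y ≤ τ <;>
      simp [h1, h2, div_eq_mul_inv]
  have hE1 : ∫ ω, (Y ω / X ω) *
        (if c * Y ω < X ω ∧ ENNReal.ofReal (Y ω) ≤ τ then (1 : ℝ) else 0) ∂P =
      ∫ y, y * I y * J (c * y) ∂γ := by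
    simp_rw [← hinner]
    rw [← integral_prod_symm F hFint, ← hmap,
      integral_map (hX.prodMk hY).aemeasurable hFm.aestronglyMeasurable]
  have hi1 : Integrable (fun y => y * I y * J (c * y)) γ := by
    simpa only [hinner] using hFint.integral_prod_right
  have hi2 : Integrable (fun y => y * I y) γ := by
    have h := integrable_rpow_gammaMeasure ha0 h𝔟 one_pos
    simp only [Real.rpow_one] at h
    refine h.mono (measurable_id.mul hIm).aestronglyMeasurable (ae_of_all _ fun y => ?_)
    rw [norm_mul, Real.norm_of_nonneg (hI01 y).1]
    exact mul_le_of_le_one_right (norm_nonneg _) (hI01 y).2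
  have hbound : ‖∫ y, ((𝔞 - 1) * c * (y * I y * J (c * y)) - 𝔟 * c * (y * I y)) ∂γ‖ ≤
      ∫ y, 2 * K * c ^ 𝔞 * y ^ 𝔞 ∂γ := by
    refine norm_integral_le_of_norm_le
      ((integrable_rpow_gammaMeasure ha0 h𝔟 ha0).const_mul _) ?_
    filter_upwards [hpos] with y hy
    have hcy : 0 < c * y := mul_pos hc hy
    have hJb : |(𝔞 - 1) * J (c * y) - 𝔟| ≤ 2 * K * (c * y) ^ (𝔞 - 1) :=
      abs_truncated_inverse_moment_sub_le h𝔞 h𝔟 hcy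
    calc ‖(𝔞 - 1) * c * (y * I y * J (c * y)) - 𝔟 * c * (y * I y)‖
        = (c * y) * I y * |(𝔞 - 1) * J (c * y) - 𝔟| := by
          rw [← abs_of_nonneg (mul_nonneg hcy.le (hI01 y).1), ← abs_mul, Real.norm_eq_abs]
          congr 1
          ring
      _ ≤ (c * y) * 1 * (2 * K * (c * y) ^ (𝔞 - 1)) := by
          gcongr
          exact (hI01 y).2
      _ = 2 * K * c ^ 𝔞 * y ^ 𝔞 := by
          rw [Real.rpow_sub_one hcy.ne', Real.mul_rpow hc.le hy.le]
          field_simp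
  rw [integral_sub (hi1.const_mul _) (hi2.const_mul _), integral_const_mul, integral_const_mul,
    integral_const_mul, Real.norm_eq_abs] at hbound
  rw [hE1, hE2]
  have hca : 0 ≤ c ^ 𝔞 := by positivity
  linarith
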